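/- arXiv:1506.08621 — 5 statements merged into one kernel-verified Lean document; each statement's English description precedes it below -/
import Mathlib

section
/- Let A and δA be n×n real symmetric matrices, let λ_1 ≥ … ≥ λ_n be the eigenvalues of A + δA and μ_1 ≥ … ≥ μ_n the eigenvalues of A (counted with multiplicity), and let Δ = min{|μ_i − μ_j| : μ_i ≠ μ_j} be the smallest gap between distinct eigenvalues of A (assume A has at least two distinct eigenvalues). Assume ρ(δA) < Δ/2. Then: (i) |λ_i − μ_i| ≤ ρ(δA) for every i; (ii) for every i, the dimension of the eigenspace of A + δA for the eigenvalue λ_i is at most the dimension of the eigenspace of A for the eigenvalue μ_i; (iii) for every i and every unit eigenvector v_i of A + δA with eigenvalue λ_i, there exists a unit eigenvector v̂_i of A with eigenvalue μ_i such that the inner product satisfies v_i · v̂_i ≥ √(1 − (ρ(δA)/(Δ/2))²). -/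
open Matrix
open scoped RealInnerProductSpace

section Diagonalized

variable {E : Type*} [NormedAddCommGroup E] [InnerProductSpace ℝ E]
  {ι : Type*} [Fintype ι]

/-- An operator that is diagonal in an orthonormal basis, with diagonal entries at most `r` in
absolute value, has operator norm at most `r`. -/
lemma norm_apply_le_of_diagonal (b : OrthonormalBasis ι ℝ E) {T : E →ₗ[ℝ] E} {ν : ι → ℝ}
    (hT : ∀ j x, ⟪b j, T x⟫ = ν j * ⟪b j, x⟫) {r : ℝ} (hr : 0 ≤ r) (hν : ∀ j, |ν j| ≤ r) (x : E) :
    ‖T x‖ ≤ r * ‖x‖ := by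
  refine le_of_sq_le_sq ?_ (by positivity)
  rw [mul_pow, ← b.sum_sq_norm_inner_right (T x), ← b.sum_sq_norm_inner_right x, Finset.mul_sum]
  refine Finset.sum_le_sum fun j _ => ?_
  rw [hT, norm_mul, mul_pow, Real.norm_eq_abs (ν j)]
  gcongr
  exact hν j

lemma inner_eq_zero_of_mem_eigenspace (b : OrthonormalBasis ι ℝ E) {T : E →ₗ[ℝ] E} {ν : ι → ℝ}
    (hT : ∀ j x, ⟪b j, T x⟫ = ν j * ⟪b j, x⟫) {m : ℝ} {p : E}
    (hp : p ∈ Module.End.eigenspace T m) {j : ι} (hj : ν j ≠ m) : ⟪b j, p⟫ = 0 := by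
  have h := hT j p
  rw [Module.End.mem_eigenspace_iff.mp hp, inner_smul_right] at h
  have : (ν j - m) * ⟪b j, p⟫ = 0 := by linarith
  exact (mul_eq_zero.mp this).resolve_left (sub_ne_zero.mpr hj)

lemma mem_eigenspace_of_diagonal (b : OrthonormalBasis ι ℝ E) {T : E →ₗ[ℝ] E} {ν : ι → ℝ}
    (hT : ∀ j x, ⟪b j, T x⟫ = ν j * ⟪b j, x⟫) (j : ι) :
    b j ∈ Module.End.eigenspace T (ν j) := by
  classical
  rw [Module.End.mem_eigenspace_iff]
  refine b.repr.injective (PiLp.ext fun k => ?_)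
  rw [b.repr_apply_apply, b.repr_apply_apply, hT, inner_smul_right, b.inner_eq_ite]
  split_ifs with h <;> simp [h]

/-- The residual `T x - l • x` controls the distance from `x` to the eigenspace of `T` for `m`,
provided every other eigenvalue of `T` is at distance at least `d` from `l`. -/
lemma mul_norm_sub_starProjection_eigenspace_le [FiniteDimensional ℝ E]
    (b : OrthonormalBasis ι ℝ E) {T : E →ₗ[ℝ] E} {ν : ι → ℝ}
    (hT : ∀ j x, ⟪b j, T x⟫ = ν j * ⟪b j, x⟫) {l m d : ℝ} (hd : 0 ≤ d)
    (hgap : ∀ j, ν j ≠ m → d ≤ |ν j - l|) (x : E) :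
    d * ‖x - (Module.End.eigenspace T m).starProjection x‖ ≤ ‖T x - l • x‖ := by
  refine le_of_sq_le_sq ?_ (norm_nonneg _)
  rw [mul_pow, ← b.sum_sq_norm_inner_right (T x - l • x), ← b.sum_sq_norm_inner_right (x - _),
    Finset.mul_sum]
  refine Finset.sum_le_sum fun j _ => ?_
  by_cases hj : ν j = m
  · have h0 : ⟪b j, x - (Module.End.eigenspace T m).starProjection x⟫ = 0 :=
      (Submodule.mem_orthogonal _ _).mp (Submodule.sub_starProjection_mem_orthogonal x) _
        (hj ▸ mem_eigenspace_of_diagonal b hT j)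
    rw [h0]
    simpa using sq_nonneg _
  · rw [inner_sub_right, inner_sub_right, hT, inner_smul_right, inner_eq_zero_of_mem_eigenspace b hT
      (Submodule.starProjection_apply_mem _ x) hj, sub_zero, ← sub_mul, norm_mul, mul_pow,
      Real.norm_eq_abs (ν j - l)]
    gcongr
    exact hgap j hj

/-- If `T` has no eigenvalue other than `m` within distance `d` of `l`, then every perturbation of
`T` of norm less than `d` has `l`-eigenspace of dimension at most that of the `m`-eigenspace
of `T`. -/
lemma finrank_eigenspace_le_of_gap [FiniteDimensional ℝ E]
    (b : OrthonormalBasis ι ℝ E) {S T : E →ₗ[ℝ] E} {ν : ι → ℝ}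
    (hT : ∀ j x, ⟪b j, T x⟫ = ν j * ⟪b j, x⟫) {l m d r : ℝ} (hd : 0 ≤ d) (hrd : r < d)
    (hgap : ∀ j, ν j ≠ m → d ≤ |ν j - l|) (hST : ∀ x, ‖S x - T x‖ ≤ r * ‖x‖) :
    Module.finrank ℝ (Module.End.eigenspace S l) ≤ Module.finrank ℝ (Module.End.eigenspace T m) := by
  refine LinearMap.finrank_le_finrank_of_injective
    (f := ((Module.End.eigenspace T m).orthogonalProjectionOnto : E →ₗ[ℝ] _).comp
      (Module.End.eigenspace S l).subtype) ?_
  rw [← LinearMap.ker_eq_bot, LinearMap.ker_eq_bot']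
  rintro ⟨x, hx⟩ h0
  have hP : (Module.End.eigenspace T m).starProjection x = 0 := by
    rw [Submodule.starProjection_apply]
    exact congrArg Subtype.val h0
  have h1 := mul_norm_sub_starProjection_eigenspace_le b hT hd hgap x
  have h2 := hST x
  rw [Module.End.mem_eigenspace_iff.mp hx, norm_sub_rev] at h2
  rw [hP, sub_zero] at h1
  have h3 : ‖x‖ = 0 := by
    by_contra hne
    have : 0 < ‖x‖ := lt_of_le_of_ne (norm_nonneg _) (Ne.symm hne)
    nlinarith
  simpa using h3

/-- If `T` has no eigenvalue other than `m` within distance `d` of `l`, then every unit vector `x`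
with `‖T x - l • x‖ ≤ r < d` is aligned with some unit eigenvector of `T` for `m`. -/
lemma exists_unit_eigenvector_sqrt_le_inner [FiniteDimensional ℝ E]
    (b : OrthonormalBasis ι ℝ E) {T : E →ₗ[ℝ] E} {ν : ι → ℝ}
    (hT : ∀ j x, ⟪b j, T x⟫ = ν j * ⟪b j, x⟫) {l m d r : ℝ} (hd : 0 ≤ d) (hrd : r < d)
    (hgap : ∀ j, ν j ≠ m → d ≤ |ν j - l|) {x : E} (hx : ‖x‖ = 1) (hTx : ‖T x - l • x‖ ≤ r) :
    ∃ w : E, T w = m • w ∧ ‖w‖ = 1 ∧ √(1 - (r / d) ^ 2) ≤ ⟪x, w⟫ := by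
  set p := (Module.End.eigenspace T m).starProjection x with hp
  have hpm : p ∈ Module.End.eigenspace T m := Submodule.starProjection_apply_mem _ x
  have hr : 0 ≤ r := (norm_nonneg _).trans hTx
  have hd0 : 0 < d := hr.trans_lt hrd
  have hq : ‖x - p‖ ≤ r / d := by
    rw [le_div_iff₀' hd0]
    exact (mul_norm_sub_starProjection_eigenspace_le b hT hd hgap x).trans hTx
  have horth : ⟪p, x - p⟫ = 0 :=
    (Submodule.mem_orthogonal _ _).mp (Submodule.sub_starProjection_mem_orthogonal x) _ hpm
  have hpx : ⟪x, p⟫ = ‖p‖ ^ 2 := by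
    rw [real_inner_comm, ← sub_add_cancel x p, inner_add_right]
    simp [horth]
  have hpyth : 1 - (r / d) ^ 2 ≤ ‖p‖ ^ 2 := by
    have h1 := norm_sub_sq_real x p
    have h2 : ‖x - p‖ ^ 2 ≤ (r / d) ^ 2 := by gcongr
    rw [hpx, hx] at h1
    linarith
  have hlt : (r / d) ^ 2 < 1 := by
    have : r / d < 1 := (div_lt_one hd0).mpr hrd
    have : 0 ≤ r / d := by positivity
    nlinarith
  have hp0 : ‖p‖ ≠ 0 := fun h => by rw [h] at hpyth; linarith
  refine ⟨‖p‖⁻¹ • p, ?_, ?_, ?_⟩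
  · rw [map_smul, Module.End.mem_eigenspace_iff.mp hpm, smul_comm]
  · rw [norm_smul, norm_inv, norm_norm, inv_mul_cancel₀ hp0]
  · rw [inner_smul_right, hpx, pow_two ‖p‖, inv_mul_cancel_left₀ hp0]
    exact Real.sqrt_le_iff.mpr ⟨norm_nonneg _, hpyth⟩

/-- **Weyl's inequality**: if the quadratic form of `S - T` is at most `r`, then the `i`-th largest
eigenvalue of `S` exceeds that of `T` by at most `r`. -/
lemma eigenvalue_le_add_of_inner_sub_le {n : ℕ} (b c : OrthonormalBasis (Fin n) ℝ E)
    {S T : E →ₗ[ℝ] E} {lam mu : Fin n → ℝ} (hlam : Antitone lam) (hmu : Antitone mu)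
    (hS : ∀ j x, ⟪c j, S x⟫ = lam j * ⟪c j, x⟫) (hT : ∀ j x, ⟪b j, T x⟫ = mu j * ⟪b j, x⟫)
    {r : ℝ} (hST : ∀ x, ⟪x, S x - T x⟫ ≤ r * ‖x‖ ^ 2) (i : Fin n) : lam i ≤ mu i + r := by
  have : FiniteDimensional ℝ E := b.toBasis.finiteDimensional_of_finite
  let f : E →ₗ[ℝ] ({j : Fin n // j ≠ i} → ℝ) :=
    LinearMap.pi fun j => innerₛₗ ℝ (if i < j.1 then c j.1 else b j.1)
  have hf : LinearMap.ker f ≠ ⊥ := by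
    refine LinearMap.ker_ne_bot_of_finrank_lt ?_
    rw [Module.finrank_fintype_fun_eq_card, Module.finrank_eq_card_basis b.toBasis]
    exact Fintype.card_subtype_lt (x := i) (by simp)
  obtain ⟨x, hxf, hx0⟩ := Submodule.exists_mem_ne_zero_of_ne_bot hf
  have hfx (j : Fin n) (hj : j ≠ i) : ⟪if i < j then c j else b j, x⟫ = 0 :=
    congrFun (LinearMap.mem_ker.mp hxf) ⟨j, hj⟩
  have hSx : lam i * ‖x‖ ^ 2 ≤ ⟪x, S x⟫ := by
    rw [← c.sum_inner_mul_inner x (S x), ← c.sum_sq_norm_inner_right x, Finset.mul_sum]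
    refine Finset.sum_le_sum fun j _ => ?_
    rw [hS, real_inner_comm (c j) x, Real.norm_eq_abs, sq_abs]
    rcases lt_or_ge i j with hij | hij
    · have := hfx j hij.ne'
      rw [if_pos hij] at this
      simp [this]
    · nlinarith [hlam hij, sq_nonneg ⟪c j, x⟫]
  have hTx : ⟪x, T x⟫ ≤ mu i * ‖x‖ ^ 2 := by
    rw [← b.sum_inner_mul_inner x (T x), ← b.sum_sq_norm_inner_right x, Finset.mul_sum]
    refine Finset.sum_le_sum fun j _ => ?_
    rw [hT, real_inner_comm (b j) x, Real.norm_eq_abs, sq_abs]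
    rcases lt_or_ge j i with hij | hij
    · have := hfx j hij.ne
      rw [if_neg hij.not_gt] at this
      simp [this]
    · nlinarith [hmu hij, sq_nonneg ⟪b j, x⟫]
  have h := hST x
  rw [inner_sub_right] at h
  have hpos : 0 < ‖x‖ ^ 2 := by positivity
  exact le_of_mul_le_mul_right (by linarith) hpos

end Diagonalized

lemma Matrix.IsHermitian.inner_eigenvectorBasis_toEuclideanLin {n : Type*} [Fintype n]
    [DecidableEq n] {A : Matrix n n ℝ} (hA : A.IsHermitian) (j : n) (x : EuclideanSpace ℝ n) :
    ⟪hA.eigenvectorBasis j, toEuclideanLin A x⟫ =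
      hA.eigenvalues j * ⟪hA.eigenvectorBasis j, x⟫ := by
  have h : toEuclideanLin A (hA.eigenvectorBasis j) =
      hA.eigenvalues j • hA.eigenvectorBasis j := by
    ext u
    simpa using congrFun (hA.mulVec_eigenvectorBasis j) u
  rw [← isSymmetric_toEuclideanLin_iff.mpr hA, h, real_inner_smul_left]

lemma Matrix.finrank_eigenspace_mulVecLin {n : Type*} [Fintype n] [DecidableEq n]
    (A : Matrix n n ℝ) (m : ℝ) :
    Module.finrank ℝ (Module.End.eigenspace A.mulVecLin m) =
      Module.finrank ℝ (Module.End.eigenspace (toEuclideanLin A) m) := by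
  rw [← LinearEquiv.finrank_map_eq (WithLp.linearEquiv 2 ℝ (n → ℝ))
    (Module.End.eigenspace (toEuclideanLin A) m)]
  suffices h : Module.End.eigenspace A.mulVecLin m = (Module.End.eigenspace (toEuclideanLin A) m).map
      (WithLp.linearEquiv 2 ℝ (n → ℝ)).toLinearMap by rw [h]
  ext x
  rw [Submodule.mem_map_equiv, Module.End.mem_eigenspace_iff, Module.End.mem_eigenspace_iff,
    ← (WithLp.linearEquiv 2 ℝ (n → ℝ)).injective.eq_iff]
  rfl

/-- perturbation lemma for eigenvalues/eigenvectors of symmetric matrices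
(a simple alternative to the Davis–Kahan theorem).
`lam` (resp. `mu`) is the nonincreasing enumeration, with multiplicity, of the eigenvalues of
`A + δA` (resp. `A`); `Δ` is the smallest gap between distinct eigenvalues of `A` (which
has at least two distinct eigenvalues); `ρ` is the spectral radius of `δA`, assumed `< Δ/2`. -/
theorem eigenvector_alignment {n : ℕ} (A δA : Matrix (Fin n) (Fin n) ℝ)
    (hA : A.IsHermitian) (hδA : δA.IsHermitian) (hAδ : (A + δA).IsHermitian)
    (lam mu : Fin n → ℝ)
    (elam : Equiv.Perm (Fin n)) (hlam : lam = hAδ.eigenvalues ∘ elam) (hlam_anti : Antitone lam)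
    (emu : Equiv.Perm (Fin n)) (hmu : mu = hA.eigenvalues ∘ emu) (hmu_anti : Antitone mu)
    (Δ ρ : ℝ)
    (hΔ : Δ = sInf {d : ℝ | ∃ i j : Fin n, mu i ≠ mu j ∧ d = |mu i - mu j|})
    (hdistinct : ∃ i j : Fin n, mu i ≠ mu j)
    (hρ : ρ = ⨆ i, |hδA.eigenvalues i|)
    (hsmall : ρ < Δ / 2) :
    (∀ i, |lam i - mu i| ≤ ρ) ∧
    (∀ i, Module.finrank ℝ (Module.End.eigenspace ((A + δA).mulVecLin) (lam i)) ≤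
        Module.finrank ℝ (Module.End.eigenspace (A.mulVecLin) (mu i))) ∧
    (∀ (i : Fin n) (v : Fin n → ℝ), (A + δA).mulVec v = lam i • v → (∑ u, v u ^ 2) = 1 →
      ∃ w : Fin n → ℝ, A.mulVec w = mu i • w ∧ (∑ u, w u ^ 2) = 1 ∧
        Real.sqrt (1 - (ρ / (Δ / 2)) ^ 2) ≤ ∑ u, v u * w u) := by
  have hρ_ge (j : Fin n) : |hδA.eigenvalues j| ≤ ρ :=
    hρ ▸ le_ciSup (f := fun i => |hδA.eigenvalues i|) (Set.finite_range _).bddAbove j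
  have hρ0 : 0 ≤ ρ := hρ ▸ Real.iSup_nonneg fun _ => abs_nonneg _
  have hgapA (i j : Fin n) (hij : mu j ≠ mu i) : Δ ≤ |mu j - mu i| :=
    hΔ ▸ csInf_le ⟨0, by rintro _ ⟨i, j, -, rfl⟩; exact abs_nonneg _⟩ ⟨j, i, hij, rfl⟩
  let b := hA.eigenvectorBasis.reindex emu.symm
  let c := hAδ.eigenvectorBasis.reindex elam.symm
  have hT (j : Fin n) (x) : ⟪b j, toEuclideanLin A x⟫ = mu j * ⟪b j, x⟫ := by
    simpa [b, hmu] using hA.inner_eigenvectorBasis_toEuclideanLin (emu j) x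
  have hS (j : Fin n) (x) : ⟪c j, toEuclideanLin (A + δA) x⟫ = lam j * ⟪c j, x⟫ := by
    simpa [c, hlam] using hAδ.inner_eigenvectorBasis_toEuclideanLin (elam j) x
  have hnorm (x) : ‖toEuclideanLin (A + δA) x - toEuclideanLin A x‖ ≤ ρ * ‖x‖ := by
    rw [map_add, LinearMap.add_apply, add_sub_cancel_left]
    exact norm_apply_le_of_diagonal _ hδA.inner_eigenvectorBasis_toEuclideanLin hρ0 hρ_ge x
  have hquad (x) : ⟪x, toEuclideanLin (A + δA) x - toEuclideanLin A x⟫ ≤ ρ * ‖x‖ ^ 2 := by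
    nlinarith [real_inner_le_norm x (toEuclideanLin (A + δA) x - toEuclideanLin A x), hnorm x,
      norm_nonneg x]
  have hquad' (x) : ⟪x, toEuclideanLin A x - toEuclideanLin (A + δA) x⟫ ≤ ρ * ‖x‖ ^ 2 := by
    have h := hnorm x
    rw [norm_sub_rev] at h
    nlinarith [real_inner_le_norm x (toEuclideanLin A x - toEuclideanLin (A + δA) x), norm_nonneg x]
  have hweyl (i : Fin n) : |lam i - mu i| ≤ ρ := by
    have h1 := eigenvalue_le_add_of_inner_sub_le b c hlam_anti hmu_anti hS hT hquad i
    have h2 := eigenvalue_le_add_of_inner_sub_le c b hmu_anti hlam_anti hT hS hquad' i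
    exact abs_le.mpr ⟨by linarith, by linarith⟩
  have hgap (i j : Fin n) (hij : mu j ≠ mu i) : Δ / 2 ≤ |mu j - lam i| := by
    have := abs_sub_le (mu j) (lam i) (mu i)
    linarith [hgapA i j hij, hweyl i]
  have hΔ0 : 0 ≤ Δ / 2 := hρ0.trans hsmall.le
  refine ⟨hweyl, fun i => ?_, fun i v hv hv1 => ?_⟩
  · rw [finrank_eigenspace_mulVecLin, finrank_eigenspace_mulVecLin]
    exact finrank_eigenspace_le_of_gap b hT hΔ0 hsmall (hgap i) hnorm
  · have hx1 : ‖WithLp.toLp 2 v‖ = 1 := by simp [EuclideanSpace.norm_eq, hv1]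
    have hx : toEuclideanLin (A + δA) (WithLp.toLp 2 v) = lam i • WithLp.toLp 2 v := by
      rw [toLpLin_toLp, toLin'_apply, hv, WithLp.toLp_smul]
    have hres := hnorm (WithLp.toLp 2 v)
    rw [hx, norm_sub_rev, hx1, mul_one] at hres
    obtain ⟨w, hw, hw1, hvw⟩ :=
      exists_unit_eigenvector_sqrt_le_inner b hT hΔ0 hsmall (hgap i) hx1 hres
    refine ⟨w.ofLp, ?_, ?_, ?_⟩
    · simpa using congrArg WithLp.ofLp hw
    · rw [← EuclideanSpace.real_norm_sq_eq, hw1, one_pow]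
    · simpa [PiLp.inner_apply, mul_comm] using hvw
end

section
/- If w ∈ R^n satisfies P w = λ w with λ ≠ 0, then w is constant on communities (w_u = w_v whenever σ_u = σ_v), and the vector y ∈ R^K whose k-th entry is the common value of w on community k satisfies Z y = (D̄ λ) y. -/
open Matrix Finset

/-- if `P w = λ w` with `λ ≠ 0`, then `w` is constant on communities, and the
vector `y` of common community values satisfies `Z y = (D̄ λ) y`. -/
theorem block_eigenvector_descend {n K : ℕ} (hK : 1 ≤ K) (hn : K ≤ n)
    (σ : Fin n → Fin K) (hσ : Function.Surjective σ)
    (Dbar : ℝ) (hDbar : 0 < Dbar)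
    (M : Fin K → ℝ) (hM : ∀ i, 0 < M i)
    (B : Matrix (Fin K) (Fin K) ℝ) (hB : B.IsSymm)
    (P : Matrix (Fin n) (Fin n) ℝ)
    (hP : ∀ u v, P u v = B (σ u) (σ v) / (n * Dbar * M (σ u) * M (σ v)))
    (Z : Matrix (Fin K) (Fin K) ℝ)
    (hZ : ∀ i j, Z i j =
      ((univ.filter fun u => σ u = j).card : ℝ) / n * B i j / (M i * M j))
    (lam : ℝ) (hlam : lam ≠ 0) (w : Fin n → ℝ) (hw : P.mulVec w = lam • w) :
    (∀ u v, σ u = σ v → w u = w v) ∧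
    ∃ y : Fin K → ℝ, (∀ u, y (σ u) = w u) ∧ Z.mulVec y = (Dbar * lam) • y := by
  have hrow : ∀ u, ∑ v, P u v * w v = lam * w u := fun u => congrFun hw u
  have hconst : ∀ u v, σ u = σ v → w u = w v := by
    intro u v huv
    apply mul_left_cancel₀ hlam
    rw [← hrow u, ← hrow v]
    exact Finset.sum_congr rfl fun x _ => by rw [hP, hP, huv]
  refine ⟨hconst, w ∘ Function.surjInv hσ,
    fun u => hconst _ _ (Function.surjInv_eq hσ (σ u)), ?_⟩
  ext i
  obtain ⟨u, rfl⟩ := hσ i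
  have hy : w (Function.surjInv hσ (σ u)) = w u :=
    hconst _ _ (Function.surjInv_eq hσ (σ u))
  simp only [Matrix.mulVec, dotProduct, Pi.smul_apply, smul_eq_mul, Function.comp_apply]
  rw [hy, mul_assoc, ← hrow u, Finset.mul_sum,
    ← Finset.sum_fiberwise_of_maps_to (fun v _ => Finset.mem_univ (σ v))]
  refine Finset.sum_congr rfl fun j _ => ?_
  have hterm : ∀ v ∈ univ.filter (fun v => σ v = j), Dbar * (P u v * w v) =
      B (σ u) j / (n * (M (σ u) * M j)) * w (Function.surjInv hσ j) := by
    intro v hv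
    obtain rfl := (Finset.mem_filter.mp hv).2
    have hn0 : (n : ℝ) ≠ 0 := Nat.cast_ne_zero.mpr (by omega)
    have hMu := (hM (σ u)).ne'
    have hMv := (hM (σ v)).ne'
    rw [hP, hconst _ _ (Function.surjInv_eq hσ (σ v))]
    field_simp
  rw [Finset.sum_congr rfl hterm, Finset.sum_const, nsmul_eq_mul, hZ]
  ring
end

section
/- Fix two distinct communities i ≠ l in {1,…,K}. Assume every community is nonempty, all weights D_u are positive, and M_k > 0 for every k. Then the following are equivalent: (1) for all j ∈ {1,…,K}, B_{ij}/M_i = B_{lj}/M_l; (2) there exist a symmetric matrix B* ∈ R_{≥0}^{K×K} and positive weights D*_1,…,D*_n with average D̄* = (1/n) Σ_u D*_u such that B*_{ij} = B*_{lj} for all j, and D_u B_{σ_u σ_v} D_v / D̄ = D*_u B*_{σ_u σ_v} D*_v / D̄* for all u, v ∈ {1,…,n}. -/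
open Matrix

/-- for two distinct communities `i ≠ l` (all communities nonempty, all
weights positive, all `M k > 0`), the condition `B i j / M i = B l j / M l` for all `j` holds
iff there are alternative parameters `(B*, D*)` — `B*` symmetric nonnegative, `D*` positive —
generating the same model (i.e. `D_u B_{σ_u σ_v} D_v / D̄ = D*_u B*_{σ_u σ_v} D*_v / D̄*` for
all `u, v`) with `B* i j = B* l j` for all `j`. -/
theorem identifiability_characterization {n K : ℕ} (hn : 0 < n)
    (σ : Fin n → Fin K) (hσ : Function.Surjective σ)
    (D : Fin n → ℝ) (hD : ∀ u, 0 < D u)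
    (B : Matrix (Fin K) (Fin K) ℝ) (hBsymm : B.IsSymm) (hBnn : ∀ a b, 0 ≤ B a b)
    (M : Fin K → ℝ) (hM : ∀ a, M a = ∑ u, D u * B a (σ u)) (hMpos : ∀ a, 0 < M a)
    (i l : Fin K) (hil : i ≠ l) :
    (∀ j, B i j / M i = B l j / M l) ↔
      ∃ (Bs : Matrix (Fin K) (Fin K) ℝ) (Ds : Fin n → ℝ),
        Bs.IsSymm ∧ (∀ a b, 0 ≤ Bs a b) ∧ (∀ u, 0 < Ds u) ∧
        (∀ j, Bs i j = Bs l j) ∧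
        (∀ u v, D u * B (σ u) (σ v) * D v / ((∑ w, D w) / n) =
          Ds u * Bs (σ u) (σ v) * Ds v / ((∑ w, Ds w) / n)) := by
  have : Nonempty (Fin n) := ⟨⟨0, hn⟩⟩
  have hn' : (0 : ℝ) < n := by exact_mod_cast hn
  have sum_pos' : ∀ E : Fin n → ℝ, (∀ u, 0 < E u) → 0 < (∑ w, E w) / n := fun E hE =>
    div_pos (Finset.sum_pos (fun u _ => hE u) Finset.univ_nonempty) hn'
  have hDbar := sum_pos' D hD
  constructor
  · intro h
    have hDs : ∀ u, 0 < D u * M (σ u) := fun u => mul_pos (hD u) (hMpos _)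
    have hDsbar := sum_pos' _ hDs
    set d := (∑ w, D w) / n
    set e := (∑ w, D w * M (σ w)) / n with he
    refine ⟨Matrix.of fun a b => e / d * (B a b / M a / M b), fun u => D u * M (σ u),
      ?_, ?_, hDs, ?_, ?_⟩
    · ext a b
      simp only [Matrix.transpose_apply, Matrix.of_apply]
      rw [hBsymm.apply a b, div_right_comm (B a b)]
    · intro a b
      have ha := hMpos a
      have hb := hMpos b
      have hab := hBnn a b
      simp only [Matrix.of_apply]
      positivity
    · intro j
      simp only [Matrix.of_apply, h j]
    · intro u v
      have hu := (hMpos (σ u)).ne'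
      have hv := (hMpos (σ v)).ne'
      simp only [Matrix.of_apply, ← he]
      field_simp
  · rintro ⟨Bs, Ds, -, -, hDs, hrow, heq⟩ j
    have hDsbar := sum_pos' Ds hDs
    obtain ⟨u, rfl⟩ := hσ i
    obtain ⟨w, rfl⟩ := hσ l
    set d := (∑ w, D w) / n
    set e := (∑ w, Ds w) / n
    have key : ∀ k, D u * Ds w * B (σ u) k = D w * Ds u * B (σ w) k := by
      intro k
      obtain ⟨v, rfl⟩ := hσ k
      have h₁ := heq u v
      have h₂ := heq w v
      rw [hrow] at h₁
      rw [div_eq_div_iff hDbar.ne' hDsbar.ne'] at h₁ h₂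
      refine mul_right_cancel₀ (mul_pos (hD v) hDsbar).ne' ?_
      linear_combination Ds w * h₁ - Ds u * h₂
    have keyM : D u * Ds w * M (σ u) = D w * Ds u * M (σ w) := by
      rw [hM, hM, Finset.mul_sum, Finset.mul_sum]
      exact Finset.sum_congr rfl fun v _ => by linear_combination D v * key (σ v)
    rw [div_eq_div_iff (hMpos _).ne' (hMpos _).ne']
    refine mul_left_cancel₀ (mul_pos (hD w) (hDs u)).ne' ?_
    linear_combination M (σ u) * key j - B (σ u) j * keyM
end

section
/- Let N be a real symmetric K×K matrix and let k ≠ l be two indices. Suppose that every eigenvector of N corresponding to a nonzero eigenvalue has equal k-th and l-th coordinates. Then the k-th and l-th rows of N are equal: N_{ku} = N_{lu} for every u ∈ {1,…,K}. -/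
open Matrix

/-- if every eigenvector of a real symmetric matrix `N` corresponding to a
nonzero eigenvalue has equal `k`-th and `l`-th coordinates, then the `k`-th and `l`-th rows
of `N` coincide. -/
theorem rows_eq_of_eigenvectors_agree {K : ℕ}
    (N : Matrix (Fin K) (Fin K) ℝ) (hNsymm : N.IsSymm)
    (k l : Fin K) (hkl : k ≠ l)
    (h : ∀ (lam : ℝ) (x : Fin K → ℝ), lam ≠ 0 → x ≠ 0 → N.mulVec x = lam • x → x k = x l) :
    ∀ u, N k u = N l u := by
  have hN : N.IsHermitian := hNsymm
  let coord (i : Fin K) : EuclideanSpace ℝ (Fin K) →ₗ[ℝ] ℝ :=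
    LinearMap.proj i ∘ₗ N.mulVecLin ∘ₗ (WithLp.linearEquiv 2 ℝ (Fin K → ℝ)).toLinearMap
  have hcoord (i : Fin K) (x : EuclideanSpace ℝ (Fin K)) : coord i x = (N *ᵥ ⇑x) i := rfl
  have heq : coord k = coord l := by
    refine hN.eigenvectorBasis.toBasis.ext fun j ↦ ?_
    rw [OrthonormalBasis.coe_toBasis, hcoord, hcoord, hN.mulVec_eigenvectorBasis,
      Pi.smul_apply, Pi.smul_apply]
    by_cases hj : hN.eigenvalues j = 0
    · simp [hj]
    · have hne : (⇑(hN.eigenvectorBasis j) : Fin K → ℝ) ≠ 0 := fun h0 ↦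
        hN.eigenvectorBasis.orthonormal.ne_zero j (PiLp.ext (congrFun h0))
      rw [h _ _ hj hne (hN.mulVec_eigenvectorBasis j)]
  intro u
  simpa [hcoord] using LinearMap.congr_fun heq (EuclideanSpace.single u 1)
end

section
/- Let p ∈ [0,1], let X be a real random variable taking values in the interval [−p, 1−p], and let U be uniformly distributed on [0,1] and independent of X. Define Y = (1−p) − 1_{X ≤ U − p}. Then Y takes values in {−p, 1−p}, E[Y | X] = X almost surely, and P(Y = 1−p) = E[X] + p. In particular, if E[X] = 0 then Y + p is a Bernoulli random variable with parameter p. -/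
open MeasureTheory ProbabilityTheory

/-- If `U` is independent of `X`, its conditional distribution given `X` is its law, so the
conditional expectation of `f (X, U)` given `X` is obtained by integrating out `U`. -/
lemma condExp_comp_prodMk_of_indepFun {Ω α : Type*} [MeasurableSpace Ω] [mα : MeasurableSpace α]
    {μ : Measure Ω} [IsProbabilityMeasure μ] {X : Ω → α} {U : Ω → ℝ}
    (hX : Measurable X) (hU : Measurable U) (hindep : IndepFun X U μ)
    {f : α × ℝ → ℝ} (hf : StronglyMeasurable f) (hf_int : Integrable (fun ω => f (X ω, U ω)) μ) :
    μ[fun ω => f (X ω, U ω) | mα.comap X] =ᵐ[μ] fun ω => ∫ u, f (X ω, u) ∂μ.map U := by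
  have : IsProbabilityMeasure (μ.map U) := Measure.isProbabilityMeasure_map hU.aemeasurable
  have hcd : condDistrib U X μ =ᵐ[μ.map X] Kernel.const α (μ.map U) := by
    rw [condDistrib_ae_eq_iff_measure_eq_compProd X hU.aemeasurable, Measure.compProd_const]
    exact (indepFun_iff_map_prod_eq_prod_map_map hX.aemeasurable hU.aemeasurable).mp hindep
  filter_upwards [condExp_prod_ae_eq_integral_condDistrib hX hU.aemeasurable hf hf_int,
    ae_of_ae_map hX.aemeasurable hcd] with ω h1 h2
  rw [h1, h2, Kernel.const_apply]

/-- The threshold indicator `1_{x ≤ u - p}` integrates over `u ∈ [0, 1]` to `1 - p - x`. -/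
lemma setIntegral_ite_le_sub {p x : ℝ} (h0 : -p ≤ x) (h1 : x ≤ 1 - p) :
    ∫ u in Set.Icc (0 : ℝ) 1, (if x ≤ u - p then (1 : ℝ) else 0) = 1 - p - x := by
  have hind : (fun u : ℝ => if x ≤ u - p then (1 : ℝ) else 0) = (Set.Ici (x + p)).indicator 1 := by
    ext u
    simp only [Set.indicator_apply, Set.mem_Ici, le_sub_iff_add_le, Pi.one_apply]
  have hset : Set.Ici (x + p) ∩ Set.Icc 0 1 = Set.Icc (x + p) 1 := by
    ext u
    simp only [Set.mem_inter_iff, Set.mem_Ici, Set.mem_Icc]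
    exact ⟨fun h => ⟨h.1, h.2.2⟩, fun h => ⟨h.1, by linarith [h.1], h.2⟩⟩
  rw [hind, integral_indicator_one measurableSet_Ici, measureReal_restrict_apply measurableSet_Ici,
    hset, Real.volume_real_Icc_of_le (by linarith)]
  ring

/-- if `X ∈ [−p, 1−p]`, `U` is uniform on `[0,1]` and independent of `X`, and
`Y = (1−p) − 1_{X ≤ U−p}`, then `Y` takes values in `{−p, 1−p}`, `E[Y | X] = X` a.s., and
`P(Y = 1−p) = E[X] + p`; in particular, if `E[X] = 0` then `Y + p` is Bernoulli(`p`). -/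
theorem bernoulli_coupling {Ω : Type*} [MeasurableSpace Ω]
    (μ : Measure Ω) [IsProbabilityMeasure μ]
    (p : ℝ) (hp0 : 0 ≤ p) (hp1 : p ≤ 1)
    (X U : Ω → ℝ) (hX : Measurable X) (hU : Measurable U)
    (hXrange : ∀ ω, -p ≤ X ω ∧ X ω ≤ 1 - p)
    (hUunif : μ.map U = volume.restrict (Set.Icc (0 : ℝ) 1))
    (hindep : IndepFun X U μ)
    (Y : Ω → ℝ) (hY : ∀ ω, Y ω = (1 - p) - if X ω ≤ U ω - p then 1 else 0) :
    (∀ ω, Y ω = -p ∨ Y ω = 1 - p) ∧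
    (μ[Y | MeasurableSpace.comap X inferInstance] =ᵐ[μ] X) ∧
    μ {ω | Y ω = 1 - p} = ENNReal.ofReal ((∫ ω, X ω ∂μ) + p) ∧
    ((∫ ω, X ω ∂μ) = 0 →
      (∀ ω, Y ω + p = 0 ∨ Y ω + p = 1) ∧ μ {ω | Y ω + p = 1} = ENNReal.ofReal p) := by
  have hS : MeasurableSet {z : ℝ × ℝ | z.1 ≤ z.2 - p} :=
    measurableSet_le measurable_fst (measurable_snd.sub_const p)
  have hval : ∀ ω, Y ω = -p ∨ Y ω = 1 - p := by
    intro ω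
    rw [hY ω]
    split_ifs
    · left; ring
    · right; ring
  let f : ℝ × ℝ → ℝ := fun z => (1 - p) - if z.1 ≤ z.2 - p then 1 else 0
  have hf : Measurable f :=
    measurable_const.sub (Measurable.ite hS measurable_const measurable_const)
  have hYf : Y = fun ω => f (X ω, U ω) := funext hY
  have hYm : Measurable Y := hYf ▸ hf.comp (hX.prodMk hU)
  have hYint : Integrable Y μ := by
    refine Integrable.of_bound hYm.aestronglyMeasurable 1 (ae_of_all _ fun ω => ?_)
    rw [Real.norm_eq_abs, abs_le]
    rcases hval ω with h | h <;> rw [h] <;> constructor <;> linarith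
  have hcond : μ[Y | MeasurableSpace.comap X inferInstance] =ᵐ[μ] X := by
    have h := condExp_comp_prodMk_of_indepFun hX hU hindep hf.stronglyMeasurable (hYf ▸ hYint)
    rw [← hYf, hUunif] at h
    filter_upwards [h] with ω hω
    have hite : IntegrableOn (fun u => if X ω ≤ u - p then (1 : ℝ) else 0) (Set.Icc 0 1) := by
      refine Integrable.of_bound (Measurable.ite (measurableSet_le measurable_const
        (measurable_id.sub_const p)) measurable_const measurable_const).aestronglyMeasurable 1
        (ae_of_all _ fun u => ?_)
      split_ifs <;> simp
    rw [hω, integral_sub (integrable_const _) hite,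
      setIntegral_ite_le_sub (hXrange ω).1 (hXrange ω).2]
    simp
  have hA : MeasurableSet {ω | Y ω = 1 - p} := hYm (measurableSet_singleton _)
  have hprob : μ {ω | Y ω = 1 - p} = ENNReal.ofReal ((∫ ω, X ω ∂μ) + p) := by
    have hYA : ∀ ω, Y ω = {ω | Y ω = 1 - p}.indicator (1 : Ω → ℝ) ω - p := by
      intro ω
      by_cases h : Y ω = 1 - p
      · rw [Set.indicator_of_mem (by exact h), h, Pi.one_apply]
      · rw [Set.indicator_of_notMem (by exact h), (hval ω).resolve_right h, zero_sub]
    have hmean : ∫ ω, Y ω ∂μ = ∫ ω, X ω ∂μ := by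
      rw [← integral_condExp hX.comap_le, integral_congr_ae hcond]
    have hmeanA : ∫ ω, Y ω ∂μ = μ.real {ω | Y ω = 1 - p} - p := by
      have hone : Integrable ({ω | Y ω = 1 - p}.indicator (1 : Ω → ℝ)) μ :=
        (integrable_const (1 : ℝ)).indicator hA
      rw [integral_congr_ae (ae_of_all _ hYA), integral_sub hone (integrable_const _),
        integral_indicator_one hA]
      simp
    rw [← hmean, hmeanA, sub_add_cancel, ofReal_measureReal]
  refine ⟨hval, hcond, hprob, fun h0 => ⟨fun ω => ?_, ?_⟩⟩
  · exact (hval ω).imp (fun h => by rw [h]; ring) (fun h => by rw [h]; ring)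
  · rw [h0, zero_add] at hprob
    simpa only [eq_sub_iff_add_eq] using hprob
end
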